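/- Let K ⊂ ℝ^d be compact and let (f_ε)_{ε∈(0,1)} be a net of smooth functions on ℝ^d with supp f_ε ⊆ K for all ε, which is {M_p}-regular, i.e., there exists (s_i) ∈ 𝕽 such that for every (h_i) ∈ 𝕽 there are C > 0 and ε_1 ∈ (0,1) with sup_{x∈K, α∈ℕ^d} |∂^α f_ε(x)|/(M_{|α|}·Π_{i=1}^{|α|} h_i) ≤ C·e^{N_{(s_i)}(1/ε)} for all ε < ε_1. Then (f_ε) is {M_p}-negligible if and only if there exists ε_0 ∈ (0,1) such that for every (h_i) ∈ 𝕽 and every smooth compactly supported κ : ℝ^d → ℂ satisfying sup_{x,α} |∂^α κ(x)|/(M_{|α|}·Π_{i=1}^{|α|} r_i) < ∞ for every (r_i) ∈ 𝕽, there is C = C_{(h_i),κ} > 0 with |∫_{ℝ^d} f_ε(x) κ(x) dx|·e^{N_{(h_i)}(1/ε)} ≤ C for all ε < ε_0. -/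

import Mathlib

open scoped BigOperators

/-- `log₊ x = max (log x) 0`. -/
noncomputable def logPlus (x : ℝ) : ℝ := max (Real.log x) 0

/-- The associated function `M(ρ) = sup_p log₊ (ρ^p / M_p)`. -/
noncomputable def assocM (Mp : ℕ → ℝ) (ρ : ℝ) : ℝ :=
  ⨆ p : ℕ, logPlus (ρ ^ p / Mp p)

/-- `N_{(r_i)}(ρ) = sup_p log₊ (ρ^p / (M_p · Π_{i=1}^p r_i))`
(the sequence `(r_i)_{i≥1}` is indexed here by `ℕ`, `r 0 = r_1`, etc.). -/
noncomputable def assocN (Mp : ℕ → ℝ) (r : ℕ → ℝ) (ρ : ℝ) : ℝ :=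
  ⨆ p : ℕ, logPlus (ρ ^ p / (Mp p * ∏ i ∈ Finset.range p, r i))

/-- `(r_i) ∈ 𝕽`: positive, monotonically increasing, tending to infinity. -/
def InRcal (r : ℕ → ℝ) : Prop :=
  (∀ i, 0 < r i) ∧ Monotone r ∧ Filter.Tendsto r Filter.atTop Filter.atTop

/-- Condition (M.1): logarithmic convexity. -/
def CondM1 (Mp : ℕ → ℝ) : Prop :=
  ∀ p : ℕ, (Mp (p + 1)) ^ 2 ≤ Mp p * Mp (p + 2)

/-- Condition (M.2) with constants `c0, H`. -/
def CondM2 (Mp : ℕ → ℝ) (c0 H : ℝ) : Prop :=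
  ∀ p q : ℕ, Mp (p + q) ≤ c0 * H ^ (p + q) * Mp p * Mp q

/-- Condition (M.2). -/
def CondM2' (Mp : ℕ → ℝ) : Prop :=
  ∃ c0 H : ℝ, 1 ≤ c0 ∧ 1 ≤ H ∧ CondM2 Mp c0 H

/-- Condition (M.3): `Σ_{j=p+1}^∞ M_{j-1}/M_j ≤ c0 · p · M_p / M_{p+1}`. -/
def CondM3 (Mp : ℕ → ℝ) : Prop :=
  ∃ c0 : ℝ, 1 ≤ c0 ∧ ∀ p : ℕ, 1 ≤ p →
    ∑' n : ℕ, Mp (p + n) / Mp (p + n + 1) ≤ c0 * p * Mp p / Mp (p + 1)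

/-- The partial derivative `∂_j` of a function on `ℝ^d`. -/
noncomputable def pderiv1 {d : ℕ} (j : Fin d) (f : EuclideanSpace ℝ (Fin d) → ℂ) :
    EuclideanSpace ℝ (Fin d) → ℂ :=
  fun x => fderiv ℝ f x (EuclideanSpace.single j 1)

/-- The multi-index partial derivative `∂^α = ∂_1^{α_1} ⋯ ∂_d^{α_d}`. -/
noncomputable def mderiv {d : ℕ} (α : Fin d → ℕ) (f : EuclideanSpace ℝ (Fin d) → ℂ) :
    EuclideanSpace ℝ (Fin d) → ℂ :=
  (List.finRange d).foldr (fun j g => (pderiv1 j)^[α j] g) f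

/-- An `{M_p}`-moderate net of smooth functions on `ℝ^d`. -/
def ModerateR {d : ℕ} (Mp : ℕ → ℝ) (f : ℝ → EuclideanSpace ℝ (Fin d) → ℂ) : Prop :=
  ∀ K' : Set (EuclideanSpace ℝ (Fin d)), IsCompact K' → ∀ h : ℕ → ℝ, InRcal h →
    ∃ k : ℕ → ℝ, InRcal k ∧ ∃ C : ℝ, 0 < C ∧ ∃ ε₀ ∈ Set.Ioo (0 : ℝ) 1,
      ∀ ε : ℝ, 0 < ε → ε < ε₀ → ∀ x ∈ K', ∀ α : Fin d → ℕ,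
        ‖mderiv α (f ε) x‖ / (Mp (∑ j, α j) * ∏ i ∈ Finset.range (∑ j, α j), h i) ≤
          C * Real.exp (assocN Mp k (1 / ε))

/-- An `{M_p}`-negligible net of smooth functions on `ℝ^d`. -/
def NegligibleR {d : ℕ} (Mp : ℕ → ℝ) (f : ℝ → EuclideanSpace ℝ (Fin d) → ℂ) : Prop :=
  ∀ K' : Set (EuclideanSpace ℝ (Fin d)), IsCompact K' → ∀ h : ℕ → ℝ, InRcal h →
    ∀ k : ℕ → ℝ, InRcal k →
      ∃ C : ℝ, 0 < C ∧ ∃ ε₀ ∈ Set.Ioo (0 : ℝ) 1,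
        ∀ ε : ℝ, 0 < ε → ε < ε₀ → ∀ x ∈ K', ∀ α : Fin d → ℕ,
          ‖mderiv α (f ε) x‖ / (Mp (∑ j, α j) * ∏ i ∈ Finset.range (∑ j, α j), h i) ≤
            C * Real.exp (-assocN Mp k (1 / ε))

/-- The iterated partial derivative `∂_{l_1} ∂_{l_2} ⋯` along a word `l` of coordinate directions. -/
noncomputable def wderiv {d : ℕ} (l : List (Fin d)) (f : EuclideanSpace ℝ (Fin d) → ℂ) :
    EuclideanSpace ℝ (Fin d) → ℂ :=
  l.foldr pderiv1 f

section Derivatives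

variable {d : ℕ} {f g : EuclideanSpace ℝ (Fin d) → ℂ}

theorem ContDiff.pderiv1 (j : Fin d) (hf : ContDiff ℝ (⊤ : ℕ∞) f) :
    ContDiff ℝ (⊤ : ℕ∞) (pderiv1 j f) :=
  (hf.fderiv_right (m := (⊤ : ℕ∞)) (by norm_cast)).clm_apply contDiff_const

theorem ContDiff.wderiv (l : List (Fin d)) (hf : ContDiff ℝ (⊤ : ℕ∞) f) :
    ContDiff ℝ (⊤ : ℕ∞) (wderiv l f) := by
  induction l with
  | nil => exact hf
  | cons j l ih => exact ih.pderiv1 j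

theorem wderiv_append (l l' : List (Fin d)) :
    wderiv (l ++ l') f = wderiv l (wderiv l' f) := by
  simp [wderiv]

theorem pderiv1_comm (i j : Fin d) (hf : ContDiff ℝ (⊤ : ℕ∞) f) :
    pderiv1 i (pderiv1 j f) = pderiv1 j (pderiv1 i f) := by
  have hd : Differentiable ℝ (fderiv ℝ f) :=
    (hf.fderiv_right (m := (⊤ : ℕ∞)) (by norm_cast)).differentiable (by simp)
  have key : ∀ (a b : Fin d) x, pderiv1 a (pderiv1 b f) x =
      fderiv ℝ (fderiv ℝ f) x (EuclideanSpace.single a 1) (EuclideanSpace.single b 1) := by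
    intro a b x
    change fderiv ℝ (fun y => fderiv ℝ f y (EuclideanSpace.single b 1)) x _ = _
    rw [fderiv_clm_apply (hd x) (differentiableAt_const _)]
    simp
  ext x
  rw [key, key]
  refine (hf.contDiffAt.isSymmSndFDerivAt ?_).eq _ _
  rw [minSmoothness_of_isRCLikeNormedField]
  exact WithTop.coe_le_coe.2 le_top

theorem wderiv_perm {l l' : List (Fin d)} (h : l.Perm l') (hf : ContDiff ℝ (⊤ : ℕ∞) f) :
    wderiv l f = wderiv l' f := by
  induction h with
  | nil => rfl
  | cons a _ ih => exact congrArg (pderiv1 a) ih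
  | swap a b l => exact pderiv1_comm b a (hf.wderiv l)
  | trans _ _ ih1 ih2 => exact ih1.trans ih2

theorem wderiv_replicate (j : Fin d) (n : ℕ) :
    wderiv (List.replicate n j) f = (pderiv1 j)^[n] f := by
  induction n with
  | zero => rfl
  | succ n ih =>
    rw [Function.iterate_succ_apply', ← ih]
    rfl

theorem mderiv_eq_wderiv (α : Fin d → ℕ) :
    mderiv α f = wderiv ((List.finRange d).flatMap fun j => List.replicate (α j) j) f := by
  unfold mderiv
  induction List.finRange d with
  | nil => rfl
  | cons j l ih => rw [List.flatMap_cons, wderiv_append, ← ih, wderiv_replicate, List.foldr_cons]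

theorem mderiv_zero : mderiv (0 : Fin d → ℕ) f = f := by
  have h : ((List.finRange d).flatMap fun j => List.replicate ((0 : Fin d → ℕ) j) j) = [] := by
    rw [List.flatMap_eq_nil_iff]
    simp
  rw [mderiv_eq_wderiv, h]
  rfl

theorem length_flatMap_replicate (α : Fin d → ℕ) :
    ((List.finRange d).flatMap fun j => List.replicate (α j) j).length = ∑ j, α j := by
  simp [List.length_flatMap, ← List.ofFn_eq_map, List.sum_ofFn]

theorem wderiv_eq_mderiv (l : List (Fin d)) (hf : ContDiff ℝ (⊤ : ℕ∞) f) :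
    wderiv l f = mderiv (fun j => l.count j) f := by
  rw [mderiv_eq_wderiv]
  refine wderiv_perm (List.perm_iff_count.2 fun j => ?_) hf
  rw [List.count_flatMap, List.sum_map_eq_nsmul_single j]
  · simp
  · intro a ha _
    simp [List.count_replicate, ha]

theorem sum_count_eq_length (l : List (Fin d)) : ∑ j, l.count j = l.length := by
  induction l with
  | nil => simp
  | cons a l ih => simp [List.count_cons, Finset.sum_add_distrib, ih]

theorem norm_iteratedFDeriv_pderiv1_le (k : ℕ) (j : Fin d) (hf : ContDiff ℝ (⊤ : ℕ∞) f)
    (x : EuclideanSpace ℝ (Fin d)) :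
    ‖iteratedFDeriv ℝ k (pderiv1 j f) x‖ ≤ ‖iteratedFDeriv ℝ (k + 1) f x‖ := by
  have hd : ContDiff ℝ k (fderiv ℝ f) := hf.fderiv_right (by norm_cast; exact le_top)
  set L : (EuclideanSpace ℝ (Fin d) →L[ℝ] ℂ) →L[ℝ] ℂ :=
    ContinuousLinearMap.apply ℝ ℂ (EuclideanSpace.single j (1 : ℝ)) with hL
  have h1 := L.norm_iteratedFDeriv_comp_left (x := x) hd.contDiffAt (n := k) le_rfl
  have h2 : ‖L‖ ≤ 1 := by
    refine ContinuousLinearMap.opNorm_le_bound _ zero_le_one fun A => ?_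
    have := A.le_opNorm (EuclideanSpace.single j (1 : ℝ))
    simpa [hL] using this
  rw [← norm_iteratedFDeriv_fderiv]
  calc ‖iteratedFDeriv ℝ k (pderiv1 j f) x‖ ≤ ‖L‖ * ‖iteratedFDeriv ℝ k (fderiv ℝ f) x‖ := h1
    _ ≤ 1 * _ := by gcongr
    _ = _ := one_mul _

theorem norm_iteratedFDeriv_wderiv_le (l : List (Fin d)) (hf : ContDiff ℝ (⊤ : ℕ∞) f) (k : ℕ)
    (x : EuclideanSpace ℝ (Fin d)) :
    ‖iteratedFDeriv ℝ k (wderiv l f) x‖ ≤ ‖iteratedFDeriv ℝ (k + l.length) f x‖ := by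
  induction l generalizing k with
  | nil => rfl
  | cons j l ih =>
    refine (norm_iteratedFDeriv_pderiv1_le k j (hf.wderiv l) x).trans ((ih (k + 1)).trans_eq ?_)
    rw [List.length_cons, add_assoc, add_comm 1]

theorem norm_wderiv_le (l : List (Fin d)) (hf : ContDiff ℝ (⊤ : ℕ∞) f)
    (x : EuclideanSpace ℝ (Fin d)) :
    ‖wderiv l f x‖ ≤ ‖iteratedFDeriv ℝ l.length f x‖ := by
  have := norm_iteratedFDeriv_wderiv_le l hf 0 x
  rwa [norm_iteratedFDeriv_zero, zero_add] at this

theorem norm_mderiv_le (α : Fin d → ℕ) (hf : ContDiff ℝ (⊤ : ℕ∞) f)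
    (x : EuclideanSpace ℝ (Fin d)) :
    ‖mderiv α f x‖ ≤ ‖iteratedFDeriv ℝ (∑ j, α j) f x‖ := by
  rw [mderiv_eq_wderiv, ← length_flatMap_replicate]
  exact norm_wderiv_le _ hf x

theorem fderiv_eq_sum_pderiv1 (x : EuclideanSpace ℝ (Fin d)) :
    fderiv ℝ f x = ∑ j, (EuclideanSpace.proj j : EuclideanSpace ℝ (Fin d) →L[ℝ] ℝ).smulRight
      (pderiv1 j f x) := by
  ext v
  have hv : v = ∑ j, v j • EuclideanSpace.single j (1 : ℝ) := by
    ext i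
    simp [Pi.single_apply]
  conv_lhs => rw [hv]
  simp [pderiv1]

theorem norm_iteratedFDeriv_le_of_wderiv (k : ℕ) (hf : ContDiff ℝ (⊤ : ℕ∞) f)
    (x : EuclideanSpace ℝ (Fin d)) (B : ℝ)
    (hB : ∀ l : List (Fin d), l.length = k → ‖wderiv l f x‖ ≤ B) :
    ‖iteratedFDeriv ℝ k f x‖ ≤ (d : ℝ) ^ k * B := by
  induction k generalizing f with
  | zero => simpa [wderiv] using hB [] rfl
  | succ k ih =>
    have hstep : ∀ j : Fin d, ‖iteratedFDeriv ℝ k (pderiv1 j f) x‖ ≤ (d : ℝ) ^ k * B := by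
      intro j
      refine ih (hf.pderiv1 j) fun l hl => ?_
      have := hB (l ++ [j]) (by simp [hl])
      rwa [wderiv_append] at this
    have heq : fderiv ℝ f = fun x => ∑ j,
        (ContinuousLinearMap.smulRightL ℝ (EuclideanSpace ℝ (Fin d)) ℂ
          (EuclideanSpace.proj j : EuclideanSpace ℝ (Fin d) →L[ℝ] ℝ)) (pderiv1 j f x) := by
      ext1 y
      rw [fderiv_eq_sum_pderiv1]
      rfl
    have hk : ∀ j : Fin d, ContDiff ℝ k (pderiv1 j f) := fun j =>
      (hf.pderiv1 j).of_le (by norm_cast; exact le_top)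
    have hsum := iteratedFDeriv_fun_sum_apply (𝕜 := ℝ) (n := k) (x := x) (u := Finset.univ)
      (f := fun j y => (ContinuousLinearMap.smulRightL ℝ (EuclideanSpace ℝ (Fin d)) ℂ
        (EuclideanSpace.proj j : EuclideanSpace ℝ (Fin d) →L[ℝ] ℝ)) (pderiv1 j f y))
      (fun j _ => ((ContinuousLinearMap.contDiff _).comp (hk j)).contDiffAt)
    rw [← norm_iteratedFDeriv_fderiv, heq, hsum]
    refine (norm_sum_le _ _).trans ?_
    calc _ ≤ ∑ j : Fin d, (d : ℝ) ^ k * B := by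
          refine Finset.sum_le_sum fun j _ => ?_
          set L := ContinuousLinearMap.smulRightL ℝ (EuclideanSpace ℝ (Fin d)) ℂ
            (EuclideanSpace.proj j : EuclideanSpace ℝ (Fin d) →L[ℝ] ℝ) with hL
          have h1 := L.norm_iteratedFDeriv_comp_left (x := x) (hk j).contDiffAt (n := k) le_rfl
          have h2 : ‖L‖ ≤ 1 := by
            refine ContinuousLinearMap.opNorm_le_bound _ zero_le_one fun c => ?_
            refine ContinuousLinearMap.opNorm_le_bound _ (by positivity) fun v => ?_
            have h3 : ‖v j‖ ≤ ‖v‖ := PiLp.norm_apply_le v j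
            have h4 : L c v = v j • c := rfl
            rw [h4, norm_smul]
            nlinarith [norm_nonneg c]
          refine h1.trans ?_
          calc ‖L‖ * ‖iteratedFDeriv ℝ k (pderiv1 j f) x‖ ≤ 1 * ((d : ℝ) ^ k * B) := by
                gcongr
                exact hstep j
            _ = _ := one_mul _
      _ = _ := by simp [pow_succ]; ring

theorem tsupport_pderiv1_subset (j : Fin d) : tsupport (pderiv1 j f) ⊆ tsupport f :=
  tsupport_fderiv_apply_subset ℝ _

theorem tsupport_wderiv_subset (l : List (Fin d)) : tsupport (wderiv l f) ⊆ tsupport f := by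
  induction l with
  | nil => rfl
  | cons j l ih => exact (tsupport_pderiv1_subset j).trans ih

theorem integral_pderiv1_mul (j : Fin d) (hf : ContDiff ℝ (⊤ : ℕ∞) f)
    (hg : ContDiff ℝ (⊤ : ℕ∞) g) (hc : HasCompactSupport f) :
    ∫ x, pderiv1 j f x * g x = -∫ x, f x * pderiv1 j g x := by
  have hc' : HasCompactSupport (pderiv1 j f) :=
    hc.mono' ((subset_tsupport _).trans (tsupport_pderiv1_subset j))
  refine neg_eq_iff_eq_neg.1 ?_
  symm
  refine integral_mul_fderiv_eq_neg_fderiv_mul_of_integrable ?_ ?_ ?_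
    (fun x _ => hf.differentiable (by simp) x) (fun x _ => hg.differentiable (by simp) x)
  · exact ((hf.pderiv1 j).continuous.mul hg.continuous).integrable_of_hasCompactSupport
      hc'.mul_right
  · exact (hf.continuous.mul (hg.pderiv1 j).continuous).integrable_of_hasCompactSupport
      hc.mul_right
  · exact (hf.continuous.mul hg.continuous).integrable_of_hasCompactSupport hc.mul_right

theorem norm_integral_wderiv_mul (l : List (Fin d)) (hf : ContDiff ℝ (⊤ : ℕ∞) f)
    (hg : ContDiff ℝ (⊤ : ℕ∞) g) (hc : HasCompactSupport f) :
    ‖∫ x, wderiv l f x * g x‖ = ‖∫ x, f x * wderiv l.reverse g x‖ := by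
  induction l generalizing g with
  | nil => rfl
  | cons j l ih =>
    have hc' : HasCompactSupport (wderiv l f) :=
      hc.mono' ((subset_tsupport _).trans (tsupport_wderiv_subset l))
    have := integral_pderiv1_mul j (hf.wderiv l) hg hc'
    calc _ = ‖-∫ x, wderiv l f x * pderiv1 j g x‖ := congrArg norm this
      _ = _ := by
        rw [norm_neg, ih (hg.pderiv1 j), List.reverse_cons, wderiv_append]
        rfl

end Derivatives

section Sequences

theorem InRcal.prod_pos {r : ℕ → ℝ} (hr : InRcal r) (p : ℕ) : 0 < ∏ i ∈ Finset.range p, r i :=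
  Finset.prod_pos fun i _ => hr.1 i

theorem InRcal.exists_pow_le {r : ℕ → ℝ} (hr : InRcal r) {b : ℝ} (hb : 0 < b) :
    ∃ C : ℝ, 0 < C ∧ ∀ p, b ^ p ≤ C * ∏ i ∈ Finset.range p, r i := by
  obtain ⟨N, hN⟩ := (hr.2.2.eventually_ge_atTop b).exists_forall_of_atTop
  have hsum : 0 < ∑ q ∈ Finset.range (N + 1), b ^ q / ∏ i ∈ Finset.range q, r i :=
    Finset.sum_pos (fun q _ => div_pos (pow_pos hb q) (hr.prod_pos q)) ⟨0, by simp⟩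
  refine ⟨_, hsum, fun p => ?_⟩
  induction p with
  | zero =>
    have := Finset.single_le_sum (f := fun q => b ^ q / ∏ i ∈ Finset.range q, r i)
      (fun q _ => (div_pos (pow_pos hb q) (hr.prod_pos q)).le)
      (Finset.mem_range.2 (Nat.succ_pos N))
    simpa using this
  | succ p ih =>
    rcases lt_or_ge p N with h | h
    · have := Finset.single_le_sum (f := fun q => b ^ q / ∏ i ∈ Finset.range q, r i)
        (fun q _ => (div_pos (pow_pos hb q) (hr.prod_pos q)).le)
        (Finset.mem_range.2 (Nat.succ_lt_succ h))
      exact (div_le_iff₀ (hr.prod_pos _)).1 this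
    · rw [pow_succ, Finset.prod_range_succ, ← mul_assoc]
      exact mul_le_mul ih (hN p h) hb.le (mul_nonneg hsum.le (hr.prod_pos p).le)

theorem inRcal_natCast_add_one : InRcal fun i => (i : ℝ) + 1 :=
  ⟨fun i => by positivity, fun i j h => by simpa using h,
    Filter.tendsto_atTop_add_const_right _ _ tendsto_natCast_atTop_atTop⟩

/-- A sequence in `𝕽` which stays below `n + 2` on the first `q n` indices, for every `n`. -/
theorem exists_inRcal_le (q : ℕ → ℕ) :
    ∃ h : ℕ → ℝ, InRcal h ∧ ∀ n i, i < q n → h i ≤ n + 2 := by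
  classical
  let P : ℕ → ℕ → Prop := fun i m => m = i ∨ i < q m
  have hP : ∀ i, ∃ m, P i m := fun i => ⟨i, Or.inl rfl⟩
  let t : ℕ → ℕ := fun i => Nat.find (hP i)
  have hle : ∀ i, t i ≤ i := fun i => Nat.find_min' (hP i) (Or.inl rfl)
  have hmono : Monotone t := by
    intro i j hij
    rcases Nat.find_spec (hP j) with h | h
    · exact (hle i).trans (hij.trans h.ge)
    · exact Nat.find_min' (hP i) (Or.inr (hij.trans_lt h))
  have htop : Filter.Tendsto t Filter.atTop Filter.atTop := by
    refine Filter.tendsto_atTop_atTop.2 fun N => ?_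
    refine ⟨N + ∑ m ∈ Finset.range N, q m, fun i hi => ?_⟩
    by_contra! hlt
    rcases Nat.find_spec (hP i) with h | h
    · change t i = i at h
      omega
    · have : q (t i) ≤ ∑ m ∈ Finset.range N, q m :=
        Finset.single_le_sum (fun _ _ => Nat.zero_le _) (Finset.mem_range.2 hlt)
      change i < q (t i) at h
      omega
  refine ⟨fun i => (t i : ℝ) + 1, ⟨fun i => by positivity, fun i j h => ?_, ?_⟩, fun n i h => ?_⟩
  · simpa using hmono h
  · exact Filter.tendsto_atTop_add_const_right _ _ (tendsto_natCast_atTop_atTop.comp htop)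
  · have : t i ≤ n := Nat.find_min' (hP i) (Or.inr h)
    have : (t i : ℝ) ≤ n := by exact_mod_cast this
    linarith

/-- Bounds against all sequences in `𝕽` amount to a single geometric bound. -/
theorem exists_geometric_bound {ι : Type*} (a : ℝ → ι → ℝ) (deg : ι → ℕ)
    (ha : ∀ h : ℕ → ℝ, InRcal h → ∃ C : ℝ, 0 < C ∧ ∃ ε₁ ∈ Set.Ioo (0 : ℝ) 1,
      ∀ ε : ℝ, 0 < ε → ε < ε₁ → ∀ i, a ε i ≤ C * ∏ j ∈ Finset.range (deg i), h j) :
    ∃ L : ℝ, 0 < L ∧ ∃ ε₁ ∈ Set.Ioo (0 : ℝ) 1,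
      ∀ ε : ℝ, 0 < ε → ε < ε₁ → ∀ i, a ε i ≤ L * L ^ deg i := by
  by_contra! hcon
  have hn : ∀ n : ℕ, ∃ ε : ℝ, 0 < ε ∧ ε < 1 / ((n : ℝ) + 2) ∧
      ∃ i, ((n : ℝ) + 2) * ((n : ℝ) + 2) ^ deg i < a ε i := fun n =>
    hcon ((n : ℝ) + 2) (by positivity) _ ⟨by positivity, by
      rw [div_lt_one (by positivity)]
      linarith [(Nat.cast_nonneg n : (0 : ℝ) ≤ n)]⟩
  choose e he0 he i hi using hn
  obtain ⟨h, hh, hle⟩ := exists_inRcal_le fun n => deg (i n)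
  obtain ⟨C, hC, ε₁, hε₁, hb⟩ := ha h hh
  obtain ⟨n, hnC, hnε⟩ : ∃ n : ℕ, C ≤ n ∧ 1 / ε₁ ≤ n := by
    obtain ⟨n, hn⟩ := exists_nat_ge (max C (1 / ε₁))
    exact ⟨n, (le_max_left _ _).trans hn, (le_max_right _ _).trans hn⟩
  have hlt : e n < ε₁ := by
    refine (he n).trans_le ?_
    rw [div_le_comm₀ (by positivity) hε₁.1]
    linarith
  have h1 := hb (e n) (he0 n) hlt (i n)
  have h2 : ∏ j ∈ Finset.range (deg (i n)), h j ≤ ((n : ℝ) + 2) ^ deg (i n) := by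
    calc _ ≤ ∏ j ∈ Finset.range (deg (i n)), ((n : ℝ) + 2) :=
          Finset.prod_le_prod (fun j _ => (hh.1 j).le)
            fun j hj => hle n j (Finset.mem_range.1 hj)
      _ = _ := by simp
  have h3 : C * ∏ j ∈ Finset.range (deg (i n)), h j ≤
      ((n : ℝ) + 2) * ((n : ℝ) + 2) ^ deg (i n) :=
    mul_le_mul (by linarith) h2 (hh.prod_pos _).le (by positivity)
  linarith [hi n]

end Sequences

section AssociatedFunction

variable {Mp : ℕ → ℝ} {r : ℕ → ℝ} {ρ ε : ℝ}

theorem CondM1.pow_le (hM1 : CondM1 Mp) (hMpos : ∀ p, 0 < Mp p) (hM0 : Mp 0 = 1) (p : ℕ) :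
    Mp 1 ^ p ≤ Mp p := by
  have hstep : ∀ p, Mp 1 * Mp p ≤ Mp (p + 1) := by
    intro p
    induction p with
    | zero => simp [hM0]
    | succ p ih =>
      refine le_of_mul_le_mul_left ?_ (hMpos p)
      nlinarith [hM1 p, hMpos (p + 1), hMpos p]
  induction p with
  | zero => simp [hM0]
  | succ p ih =>
    rw [pow_succ']
    exact (mul_le_mul_of_nonneg_left ih (hMpos 1).le).trans (hstep p)

theorem exp_logPlus {x : ℝ} (hx : 0 < x) : Real.exp (logPlus x) = max x 1 := by
  rw [logPlus, Real.exp_monotone.map_max, Real.exp_log hx, Real.exp_zero]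

theorem bddAbove_assocN (hM1 : CondM1 Mp) (hMpos : ∀ p, 0 < Mp p) (hM0 : Mp 0 = 1)
    (hr : InRcal r) (hρ : 0 < ρ) :
    BddAbove (Set.range fun p : ℕ => logPlus (ρ ^ p / (Mp p * ∏ i ∈ Finset.range p, r i))) := by
  obtain ⟨C, hC, hb⟩ := hr.exists_pow_le (div_pos hρ (hMpos 1))
  refine ⟨logPlus C, ?_⟩
  rintro _ ⟨p, rfl⟩
  have hpos : 0 < ρ ^ p / (Mp p * ∏ i ∈ Finset.range p, r i) :=
    div_pos (pow_pos hρ p) (mul_pos (hMpos p) (hr.prod_pos p))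
  refine max_le_max (Real.log_le_log hpos ?_) le_rfl
  rw [div_le_iff₀ (mul_pos (hMpos p) (hr.prod_pos p))]
  have h1 := hb p
  rw [div_pow, div_le_iff₀ (pow_pos (hMpos 1) p)] at h1
  calc ρ ^ p ≤ C * (∏ i ∈ Finset.range p, r i) * Mp 1 ^ p := h1
    _ ≤ C * (∏ i ∈ Finset.range p, r i) * Mp p :=
      mul_le_mul_of_nonneg_left (hM1.pow_le hMpos hM0 p) (mul_pos hC (hr.prod_pos p)).le
    _ = _ := by ring

theorem assocN_mono (hM1 : CondM1 Mp) (hMpos : ∀ p, 0 < Mp p) (hM0 : Mp 0 = 1)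
    (hr : InRcal r) (hρ : 0 < ρ) {ρ' : ℝ} (h : ρ ≤ ρ') : assocN Mp r ρ ≤ assocN Mp r ρ' := by
  refine ciSup_mono (bddAbove_assocN hM1 hMpos hM0 hr (hρ.trans_le h)) fun p => ?_
  have hd := mul_pos (hMpos p) (hr.prod_pos p)
  refine max_le_max (Real.log_le_log (div_pos (pow_pos hρ p) hd) ?_) le_rfl
  gcongr

theorem pow_div_le_exp_assocN (hM1 : CondM1 Mp) (hMpos : ∀ p, 0 < Mp p) (hM0 : Mp 0 = 1)
    (hr : InRcal r) (hρ : 0 < ρ) (p : ℕ) :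
    ρ ^ p / (Mp p * ∏ i ∈ Finset.range p, r i) ≤ Real.exp (assocN Mp r ρ) := by
  have hpos : 0 < ρ ^ p / (Mp p * ∏ i ∈ Finset.range p, r i) :=
    div_pos (pow_pos hρ p) (mul_pos (hMpos p) (hr.prod_pos p))
  calc _ ≤ Real.exp (logPlus (ρ ^ p / (Mp p * ∏ i ∈ Finset.range p, r i))) := by
        rw [exp_logPlus hpos]
        exact le_max_left _ _
    _ ≤ _ := Real.exp_le_exp.2 (le_ciSup (bddAbove_assocN hM1 hMpos hM0 hr hρ) p)

theorem exp_assocN_mul_le (hMpos : ∀ p, 0 < Mp p) (hr : InRcal r) (hρ : 0 < ρ) {Q B : ℝ}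
    (hQ : 0 ≤ Q) (h1 : Q ≤ B)
    (h : ∀ p, ρ ^ p / (Mp p * ∏ i ∈ Finset.range p, r i) * Q ≤ B) :
    Real.exp (assocN Mp r ρ) * Q ≤ B := by
  rcases hQ.eq_or_lt with rfl | hQ
  · simpa using h1
  have hB : 0 < B := hQ.trans_le h1
  rw [← le_div_iff₀ hQ, ← Real.le_log_iff_exp_le (div_pos hB hQ)]
  refine ciSup_le fun p => ?_
  have hpos : 0 < ρ ^ p / (Mp p * ∏ i ∈ Finset.range p, r i) :=
    div_pos (pow_pos hρ p) (mul_pos (hMpos p) (hr.prod_pos p))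
  rw [Real.le_log_iff_exp_le (div_pos hB hQ), exp_logPlus hpos, le_div_iff₀ hQ,
    max_mul_of_nonneg _ _ hQ.le]
  exact max_le (h p) (by simpa using h1)

/-- `Q` decreases like the (unweighted) associated function of `Mp` at `1 / ε`. -/
def RapidBound (Mp : ℕ → ℝ) (C L ε Q : ℝ) : Prop :=
  ∀ p : ℕ, Q ≤ C * L ^ p * Mp p * ε ^ p

theorem exists_rapidBound_exp_assocN_mul {c H : ℝ} (hc : 1 ≤ c) (hH : 1 ≤ H)
    (hM2 : CondM2 Mp c H) (hMpos : ∀ p, 0 < Mp p) (hr : InRcal r)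
    {C L : ℝ} (hC : 0 < C) (hL : 0 < L) :
    ∃ C' L' : ℝ, 0 < C' ∧ 0 < L' ∧ ∀ ε Q : ℝ, 0 < ε → 0 ≤ Q → RapidBound Mp C L ε Q →
      RapidBound Mp C' L' ε (Real.exp (assocN Mp r (1 / ε)) * Q) := by
  have hLH : 0 < L * H := mul_pos hL (by linarith)
  obtain ⟨B, hB, hb⟩ := hr.exists_pow_le hLH
  have hB1 : 1 ≤ B := by simpa using hb 0
  refine ⟨C * c * B, L * H, by positivity, hLH, fun ε Q hε hQ h p => ?_⟩
  have hcB : C ≤ C * c * B := by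
    rw [mul_assoc]
    exact le_mul_of_one_le_right hC.le (one_le_mul_of_one_le_of_one_le hc hB1)
  refine exp_assocN_mul_le hMpos hr (by positivity) hQ ?_ fun q => ?_
  · refine (h p).trans ?_
    have := hMpos p
    gcongr
    exact le_mul_of_one_le_right hL.le hH
  · have hR := hr.prod_pos q
    have hq := hMpos q
    have hp := hMpos p
    rw [div_mul_eq_mul_div, div_le_iff₀ (mul_pos hq hR)]
    calc (1 / ε) ^ q * Q ≤ (1 / ε) ^ q * (C * L ^ (q + p) * Mp (q + p) * ε ^ (q + p)) := by
          gcongr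
          exact h (q + p)
      _ ≤ (1 / ε) ^ q * (C * L ^ (q + p) * (c * H ^ (q + p) * Mp q * Mp p) * ε ^ (q + p)) := by
          gcongr
          exact hM2 q p
      _ = C * c * (L * H) ^ q * (L * H) ^ p * Mp p * ε ^ p * Mp q := by
          rw [one_div, inv_pow, mul_pow, mul_pow]
          field_simp
          ring
      _ ≤ C * c * (B * ∏ i ∈ Finset.range q, r i) * (L * H) ^ p * Mp p * ε ^ p * Mp q := by
          have := hb q
          gcongr
      _ = _ := by ring

theorem exists_rapidBound_exp_assocN_pow_mul {c H : ℝ} (hc : 1 ≤ c) (hH : 1 ≤ H)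
    (hM2 : CondM2 Mp c H) (hMpos : ∀ p, 0 < Mp p) (hr : InRcal r) (n : ℕ)
    {C L : ℝ} (hC : 0 < C) (hL : 0 < L) :
    ∃ C' L' : ℝ, 0 < C' ∧ 0 < L' ∧ ∀ ε Q : ℝ, 0 < ε → 0 ≤ Q → RapidBound Mp C L ε Q →
      RapidBound Mp C' L' ε (Real.exp (assocN Mp r (1 / ε)) ^ n * Q) := by
  induction n with
  | zero => exact ⟨C, L, hC, hL, fun ε Q _ _ h => by simpa using h⟩
  | succ n ih =>
    obtain ⟨C₁, L₁, hC₁, hL₁, h₁⟩ := ih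
    obtain ⟨C₂, L₂, hC₂, hL₂, h₂⟩ :=
      exists_rapidBound_exp_assocN_mul hc hH hM2 hMpos hr hC₁ hL₁
    refine ⟨C₂, L₂, hC₂, hL₂, fun ε Q hε hQ h => ?_⟩
    rw [pow_succ', mul_assoc]
    exact h₂ ε _ hε (by positivity) (h₁ ε Q hε hQ h)

theorem CondM2.mul_le {c H : ℝ} (hc : 1 ≤ c) (hH : 1 ≤ H) (hM2 : CondM2 Mp c H)
    (hMpos : ∀ p, 0 < Mp p) (hM0 : Mp 0 = 1) (n p : ℕ) :
    Mp (n * p) ≤ c ^ n * (H ^ (n * n)) ^ p * Mp p ^ n := by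
  induction n with
  | zero => simp [hM0]
  | succ n ih =>
    have hp := hMpos p
    have hH0 : 0 < H := by linarith
    calc Mp ((n + 1) * p) = Mp (n * p + p) := by rw [add_mul, one_mul]
      _ ≤ c * H ^ (n * p + p) * Mp (n * p) * Mp p := hM2 _ _
      _ ≤ c * H ^ (n * p + p) * (c ^ n * (H ^ (n * n)) ^ p * Mp p ^ n) * Mp p := by gcongr
      _ = c ^ (n + 1) * H ^ ((n * n + n + 1) * p) * Mp p ^ (n + 1) := by
          ring
      _ ≤ c ^ (n + 1) * H ^ ((n + 1) * (n + 1) * p) * Mp p ^ (n + 1) := by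
          gcongr
          nlinarith
      _ = _ := by rw [← pow_mul]

theorem exists_rapidBound_of_pow {c H : ℝ} (hc : 1 ≤ c) (hH : 1 ≤ H)
    (hM2 : CondM2 Mp c H) (hMpos : ∀ p, 0 < Mp p) (hM0 : Mp 0 = 1) {n : ℕ} (hn : n ≠ 0)
    {C L : ℝ} (hC : 0 < C) (hL : 0 < L) :
    ∃ C' L' : ℝ, 0 < C' ∧ 0 < L' ∧ ∀ ε Q : ℝ, 0 < ε → 0 ≤ Q → RapidBound Mp C L ε (Q ^ n) →
      RapidBound Mp C' L' ε Q := by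
  have hH0 : 0 < H := by linarith
  refine ⟨max C 1 * c, L * H ^ n, by positivity, by positivity, fun ε Q hε hQ h p => ?_⟩
  have hp := hMpos p
  refine le_of_pow_le_pow_left₀ hn (by positivity) ?_
  calc Q ^ n ≤ C * L ^ (n * p) * Mp (n * p) * ε ^ (n * p) := h (n * p)
    _ ≤ max C 1 ^ n * L ^ (n * p) * (c ^ n * (H ^ (n * n)) ^ p * Mp p ^ n) * ε ^ (n * p) := by
        have := hM2.mul_le hc hH hMpos hM0 n p
        have := (hMpos (n * p)).le
        gcongr
        exact (le_max_left C 1).trans (le_self_pow₀ (le_max_right C 1) hn)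
    _ = _ := by
        rw [mul_pow, mul_pow, mul_pow, mul_pow, mul_pow]
        simp only [← pow_mul]
        ring

end AssociatedFunction

section UniformBoundedness

variable {d : ℕ}

/-- The smooth functions supported in `K` whose derivatives of order `k` are bounded by `W k`. -/
def TestBall (K : Set (EuclideanSpace ℝ (Fin d))) (W : ℕ → ℝ) : Type :=
  {κ : EuclideanSpace ℝ (Fin d) → ℂ // ContDiff ℝ (⊤ : ℕ∞) κ ∧ tsupport κ ⊆ K ∧
    ∀ k x, ‖iteratedFDeriv ℝ k κ x‖ ≤ W k}

variable {K : Set (EuclideanSpace ℝ (Fin d))} {W : ℕ → ℝ}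

/-- The superposition of the members of `TestBall K W` with coefficients `c`. -/
noncomputable def superposition (c : lp (fun _ : TestBall K W => ℂ) 1)
    (x : EuclideanSpace ℝ (Fin d)) : ℂ :=
  ∑' i, c i * i.1 x

theorem TestBall.norm_le (i : TestBall K W) (x : EuclideanSpace ℝ (Fin d)) : ‖i.1 x‖ ≤ W 0 := by
  simpa using i.2.2.2 0 x

theorem summable_norm_lp_one {ι : Type*} (c : lp (fun _ : ι => ℂ) 1) :
    Summable fun i => ‖c i‖ := by
  simpa using (lp.memℓp c).summable (by simp)

theorem norm_lp_one_eq {ι : Type*} (c : lp (fun _ : ι => ℂ) 1) : ‖c‖ = ∑' i, ‖c i‖ := by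
  simpa using lp.norm_eq_tsum_rpow (p := 1) (by simp) c

theorem norm_iteratedFDeriv_term_le (c : lp (fun _ : TestBall K W => ℂ) 1) (k : ℕ)
    (i : TestBall K W) (x : EuclideanSpace ℝ (Fin d)) :
    ‖iteratedFDeriv ℝ k (fun y => c i * i.1 y) x‖ ≤ ‖c i‖ * W k := by
  have h : (fun y => c i * i.1 y) = c i • i.1 := rfl
  rw [h, iteratedFDeriv_const_smul_apply
    (i.2.1.of_le (by norm_cast; exact le_top)).contDiffAt, norm_smul]
  exact mul_le_mul_of_nonneg_left (i.2.2.2 k x) (norm_nonneg _)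

theorem contDiff_superposition (c : lp (fun _ : TestBall K W => ℂ) 1) :
    ContDiff ℝ (⊤ : ℕ∞) (superposition c) :=
  contDiff_tsum (fun i => contDiff_const.mul i.2.1)
    (fun k _ => (summable_norm_lp_one c).mul_right (W k))
    fun k i x _ => norm_iteratedFDeriv_term_le c k i x

theorem norm_iteratedFDeriv_superposition_le (c : lp (fun _ : TestBall K W => ℂ) 1) (k : ℕ)
    (x : EuclideanSpace ℝ (Fin d)) :
    ‖iteratedFDeriv ℝ k (superposition c) x‖ ≤ ‖c‖ * W k := by
  have h := iteratedFDeriv_tsum_apply (𝕜 := ℝ) (N := (⊤ : ℕ∞))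
    (f := fun (i : TestBall K W) y => c i * i.1 y) (v := fun k i => ‖c i‖ * W k)
    (fun i => contDiff_const.mul i.2.1)
    (fun k _ => (summable_norm_lp_one c).mul_right (W k))
    (fun k i x _ => norm_iteratedFDeriv_term_le c k i x) (k := k) le_top x
  calc _ = ‖∑' i : TestBall K W, iteratedFDeriv ℝ k (fun y => c i * i.1 y) x‖ := congrArg norm h
    _ ≤ ∑' i : TestBall K W, ‖c i‖ * W k :=
      tsum_of_norm_bounded ((summable_norm_lp_one c).mul_right (W k)).hasSum
        fun i => norm_iteratedFDeriv_term_le c k i x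
    _ = _ := by rw [tsum_mul_right, norm_lp_one_eq]

theorem tsupport_superposition_subset (hK : IsClosed K) (c : lp (fun _ : TestBall K W => ℂ) 1) :
    tsupport (superposition c) ⊆ K := by
  refine closure_minimal (Function.support_subset_iff'.2 fun x hx => ?_) hK
  have h : ∀ i : TestBall K W, c i * i.1 x = 0 := fun i => by
    rw [image_eq_zero_of_notMem_tsupport fun h => hx (i.2.2.1 h), mul_zero]
  simp [superposition, h]

theorem summable_superposition (c : lp (fun _ : TestBall K W => ℂ) 1)
    (x : EuclideanSpace ℝ (Fin d)) : Summable fun i : TestBall K W => c i * i.1 x :=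
  ((summable_norm_lp_one c).mul_right (W 0)).of_norm_bounded fun i => by
    rw [norm_mul]
    exact mul_le_mul_of_nonneg_left (i.norm_le x) (norm_nonneg _)

theorem superposition_smul (a : ℂ) (c : lp (fun _ : TestBall K W => ℂ) 1)
    (x : EuclideanSpace ℝ (Fin d)) : superposition (a • c) x = a * superposition c x := by
  rw [superposition, superposition, ← tsum_mul_left]
  simp [mul_assoc]

/-- Integration against `g`, as a functional on coefficient families. -/
noncomputable def superpositionIntegral (K : Set (EuclideanSpace ℝ (Fin d))) (W : ℕ → ℝ)
    (g : EuclideanSpace ℝ (Fin d) → ℂ) (hg : MeasureTheory.Integrable g) :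
    lp (fun _ : TestBall K W => ℂ) 1 →L[ℂ] ℂ :=
  have hbd : ∀ (c : lp (fun _ : TestBall K W => ℂ) 1) x, ‖superposition c x‖ ≤ ‖c‖ * W 0 :=
    fun c x => by simpa using norm_iteratedFDeriv_superposition_le c 0 x
  have hint : ∀ c : lp (fun _ : TestBall K W => ℂ) 1,
      MeasureTheory.Integrable fun x => g x * superposition c x := fun c =>
    hg.mul_bdd (contDiff_superposition c).continuous.aestronglyMeasurable
      (Filter.Eventually.of_forall (hbd c))
  LinearMap.mkContinuous
    { toFun := fun c => ∫ x, g x * superposition c x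
      map_add' := fun c c' => by
        rw [← MeasureTheory.integral_add (hint c) (hint c')]
        congr 1 with x
        rw [← mul_add, superposition, superposition, superposition,
          ← (summable_superposition c x).tsum_add (summable_superposition c' x)]
        simp [add_mul]
      map_smul' := fun a c => by
        rw [RingHom.id_apply, smul_eq_mul, ← MeasureTheory.integral_const_mul]
        congr 1 with x
        rw [superposition_smul, mul_left_comm] }
    ((∫ x, ‖g x‖) * W 0) fun c => by
      calc ‖∫ x, g x * superposition c x‖ ≤ ∫ x, ‖g x‖ * (‖c‖ * W 0) := by
            refine MeasureTheory.norm_integral_le_of_norm_le (hg.norm.mul_const _)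
              (Filter.Eventually.of_forall fun x => ?_)
            rw [norm_mul]
            exact mul_le_mul_of_nonneg_left (hbd c x) (norm_nonneg _)
        _ = (∫ x, ‖g x‖) * W 0 * ‖c‖ := by
            rw [MeasureTheory.integral_mul_const]
            ring

theorem superpositionIntegral_apply {g : EuclideanSpace ℝ (Fin d) → ℂ}
    (hg : MeasureTheory.Integrable g) (c : lp (fun _ : TestBall K W => ℂ) 1) :
    superpositionIntegral K W g hg c = ∫ x, g x * superposition c x :=
  rfl

theorem superposition_single [DecidableEq (TestBall K W)] (i : TestBall K W) :
    superposition (lp.single 1 i (1 : ℂ)) = i.1 := by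
  ext x
  rw [superposition, tsum_eq_single i]
  · simp
  · intro j hj
    simp [hj]

theorem norm_integral_testBall_le {g : EuclideanSpace ℝ (Fin d) → ℂ}
    (hg : MeasureTheory.Integrable g) (i : TestBall K W) :
    ‖∫ x, g x * i.1 x‖ ≤ ‖superpositionIntegral K W g hg‖ := by
  classical
  have h := (superpositionIntegral K W g hg).le_opNorm (lp.single 1 i (1 : ℂ))
  have hn : ‖(lp.single 1 i (1 : ℂ) : lp (fun _ : TestBall K W => ℂ) 1)‖ = 1 := by
    rw [lp.norm_single one_pos, norm_one]
  rwa [superpositionIntegral_apply, superposition_single, hn, mul_one] at h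

/-- A family of integrable functions which is pointwise bounded as functionals on test functions
with weighted derivative bounds is uniformly bounded there. -/
theorem exists_uniform_bound_of_pointwise {J : Type*} (hK : IsClosed K)
    (g : J → EuclideanSpace ℝ (Fin d) → ℂ) (hg : ∀ j, MeasureTheory.Integrable (g j))
    (hpt : ∀ κ : EuclideanSpace ℝ (Fin d) → ℂ, ContDiff ℝ (⊤ : ℕ∞) κ → tsupport κ ⊆ K →
      (∃ B, ∀ k x, ‖iteratedFDeriv ℝ k κ x‖ ≤ B * W k) →
      ∃ C, ∀ j, ‖∫ x, g j x * κ x‖ ≤ C) :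
    ∃ C, 0 < C ∧ ∀ κ : EuclideanSpace ℝ (Fin d) → ℂ, ContDiff ℝ (⊤ : ℕ∞) κ → tsupport κ ⊆ K →
      ∀ A, 0 < A → (∀ k x, ‖iteratedFDeriv ℝ k κ x‖ ≤ A * W k) →
        ∀ j, ‖∫ x, g j x * κ x‖ ≤ A * C := by
  obtain ⟨C, hC⟩ := banach_steinhaus (g := fun j => superpositionIntegral K W (g j) (hg j))
    fun c => hpt _ (contDiff_superposition c) (tsupport_superposition_subset hK c)
      ⟨‖c‖, norm_iteratedFDeriv_superposition_le c⟩
  refine ⟨max C 1, by positivity, fun κ hκ hsupp A hA hb j => ?_⟩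
  obtain ⟨i, hi⟩ : ∃ i : TestBall K W, i.1 = ((A⁻¹ : ℝ) : ℂ) • κ :=
    ⟨⟨((A⁻¹ : ℝ) : ℂ) • κ, hκ.const_smul ((A⁻¹ : ℝ) : ℂ),
      (tsupport_smul_subset_right (fun _ => ((A⁻¹ : ℝ) : ℂ)) κ).trans hsupp, fun k x => by
      rw [iteratedFDeriv_const_smul_apply (hκ.of_le (by norm_cast; exact le_top)).contDiffAt,
        norm_smul, Complex.norm_real, Real.norm_of_nonneg (inv_pos.2 hA).le,
        inv_mul_le_iff₀ hA]
      exact hb k x⟩, rfl⟩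
  have h1 : ‖∫ x, g j x * i.1 x‖ ≤ C := (norm_integral_testBall_le (hg j) i).trans (hC j)
  have h2 : ∫ x, g j x * κ x = A * ∫ x, g j x * i.1 x := by
    rw [← MeasureTheory.integral_const_mul]
    congr 1 with x
    have : (A : ℂ) ≠ 0 := by exact_mod_cast hA.ne'
    simp only [hi, Pi.smul_apply, smul_eq_mul, Complex.ofReal_inv]
    field_simp
  rw [h2, norm_mul, Complex.norm_real, Real.norm_of_nonneg hA.le]
  exact mul_le_mul_of_nonneg_left (h1.trans (le_max_left _ _)) hA.le

end UniformBoundedness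

section SupNorm

/-- A sup bound from a Lipschitz bound and an `L²` bound. -/
theorem exists_norm_pow_le_of_lipschitz (d : ℕ) :
    ∃ C : ℝ, 0 < C ∧ ∀ (g : EuclideanSpace ℝ (Fin d) → ℂ) (B S : ℝ), 0 < B →
      Differentiable ℝ g → (∀ x, ‖fderiv ℝ g x‖ ≤ B) →
      MeasureTheory.Integrable (fun x => ‖g x‖ ^ 2) → ∫ x, ‖g x‖ ^ 2 ≤ S →
      ∀ x, ‖g x‖ ^ (d + 2) ≤ C * B ^ d * S := by
  set v := (MeasureTheory.volume (Metric.ball (0 : EuclideanSpace ℝ (Fin d)) 1)).toReal with hv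
  have hvpos : 0 < v := ENNReal.toReal_pos
    (Metric.measure_ball_pos _ _ one_pos).ne' MeasureTheory.measure_ball_lt_top.ne
  refine ⟨2 ^ (d + 2) / v, by positivity, fun g B S hB hdiff hder hint hS x => ?_⟩
  rcases (norm_nonneg (g x)).eq_or_lt with h0 | h0
  · have : 0 ≤ S := (MeasureTheory.integral_nonneg fun x => by positivity).trans hS
    rw [← h0, zero_pow (by omega)]
    positivity
  set A := ‖g x‖
  have hR : 0 < A / (2 * B) := by positivity
  have hlow : ∀ y ∈ Metric.ball x (A / (2 * B)), A / 2 ≤ ‖g y‖ := by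
    intro y hy
    have h1 : ‖g y - g x‖ ≤ B * ‖y - x‖ :=
      convex_univ.norm_image_sub_le_of_norm_fderiv_le (fun z _ => hdiff z) (fun z _ => hder z)
        (Set.mem_univ x) (Set.mem_univ y)
    have h2 : B * ‖y - x‖ ≤ A / 2 := by
      have : ‖y - x‖ ≤ A / (2 * B) := by
        rw [← dist_eq_norm]
        exact (Metric.mem_ball.1 hy).le
      calc _ ≤ B * (A / (2 * B)) := by gcongr
        _ = _ := by field_simp
    have h3 : A ≤ ‖g y‖ + ‖g y - g x‖ := by
      have := norm_sub_le (g y) (g y - g x)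
      simpa using this
    linarith
  have hvol : (MeasureTheory.volume (Metric.ball x (A / (2 * B)))).toReal =
      (A / (2 * B)) ^ d * v := by
    rw [MeasureTheory.Measure.addHaar_ball_of_pos _ _ hR, ENNReal.toReal_mul,
      ENNReal.toReal_ofReal (by positivity), finrank_euclideanSpace_fin]
  have hI : (A / 2) ^ 2 * ((A / (2 * B)) ^ d * v) ≤ S := by
    calc (A / 2) ^ 2 * ((A / (2 * B)) ^ d * v)
        = ∫ _ in Metric.ball x (A / (2 * B)), (A / 2) ^ 2 := by
          rw [MeasureTheory.setIntegral_const, MeasureTheory.measureReal_def, hvol, smul_eq_mul,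
            mul_comm]
      _ ≤ ∫ y in Metric.ball x (A / (2 * B)), ‖g y‖ ^ 2 := by
          refine MeasureTheory.setIntegral_mono_on ?_ hint.integrableOn measurableSet_ball ?_
          · exact MeasureTheory.integrableOn_const MeasureTheory.measure_ball_lt_top.ne
          · intro y hy
            have := hlow y hy
            gcongr
      _ ≤ ∫ y, ‖g y‖ ^ 2 :=
          MeasureTheory.setIntegral_le_integral hint
            (Filter.Eventually.of_forall fun y => by positivity)
      _ ≤ S := hS
  calc A ^ (d + 2) = 2 ^ (d + 2) / v * B ^ d * ((A / 2) ^ 2 * ((A / (2 * B)) ^ d * v)) := by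
        rw [div_pow, div_pow, mul_pow]
        field_simp
        ring
    _ ≤ _ := by gcongr

end SupNorm

section Regularity

variable {d : ℕ} {Mp : ℕ → ℝ} {K : Set (EuclideanSpace ℝ (Fin d))}

theorem integral_norm_sq_wderiv_le {c H : ℝ} (hc : 1 ≤ c) (hH : 1 ≤ H) (hM2 : CondM2 Mp c H)
    (hMpos : ∀ p, 0 < Mp p) (hK : IsCompact K) {u : EuclideanSpace ℝ (Fin d) → ℂ}
    (hu : ContDiff ℝ (⊤ : ℕ∞) u) (hsupp : tsupport u ⊆ K) {G L D : ℝ} (hG : 0 < G) (hL : 0 < L)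
    (hD : 0 ≤ D) (hbd : ∀ k x, ‖iteratedFDeriv ℝ k u x‖ ≤ G * L ^ k * Mp k)
    (hdual : ∀ κ : EuclideanSpace ℝ (Fin d) → ℂ, ContDiff ℝ (⊤ : ℕ∞) κ → tsupport κ ⊆ K →
      ∀ A, 0 < A → (∀ k x, ‖iteratedFDeriv ℝ k κ x‖ ≤ A * ((L * H) ^ k * Mp k)) →
        ‖∫ x, u x * κ x‖ ≤ A * D)
    (l : List (Fin d)) :
    ∫ x, ‖wderiv l u x‖ ^ 2 ≤
      G * c ^ 2 * ((L * H ^ 2) ^ l.length * Mp l.length) ^ 2 * D := by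
  set q := l.length with hq
  have hH0 : 0 < H := by linarith
  have huc : HasCompactSupport u := hK.of_isClosed_subset (isClosed_tsupport u) hsupp
  set v : EuclideanSpace ℝ (Fin d) → ℂ := Complex.conjCLE ∘ wderiv l u with hv
  have hvs : ContDiff ℝ (⊤ : ℕ∞) v := Complex.conjCLE.contDiff.comp (hu.wderiv l)
  have hvsupp : tsupport v ⊆ K :=
    (tsupport_comp_subset (map_zero Complex.conjCLE) _).trans
      ((tsupport_wderiv_subset l).trans hsupp)
  have hκ : ∀ k x, ‖iteratedFDeriv ℝ k (wderiv l.reverse v) x‖ ≤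
      (G * L ^ (2 * q) * (c * H ^ (2 * q) * Mp (2 * q))) * ((L * H) ^ k * Mp k) := by
    intro k x
    have h2q := hMpos (2 * q)
    calc _ ≤ ‖iteratedFDeriv ℝ (k + q) v x‖ := by
          have h := norm_iteratedFDeriv_wderiv_le l.reverse hvs k x
          rwa [List.length_reverse] at h
      _ = ‖iteratedFDeriv ℝ (k + q) (wderiv l u) x‖ :=
          Complex.conjLIE.norm_iteratedFDeriv_comp_left (wderiv l u) x (k + q)
      _ ≤ ‖iteratedFDeriv ℝ (k + q + q) u x‖ := norm_iteratedFDeriv_wderiv_le l hu (k + q) x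
      _ ≤ G * L ^ (k + q + q) * Mp (k + q + q) := hbd _ x
      _ = G * L ^ (k + 2 * q) * Mp (k + 2 * q) := by rw [two_mul, add_assoc]
      _ ≤ G * L ^ (k + 2 * q) * (c * H ^ (k + 2 * q) * Mp k * Mp (2 * q)) := by
          gcongr
          exact hM2 k (2 * q)
      _ = _ := by ring
  have hA : 0 < G * L ^ (2 * q) * (c * H ^ (2 * q) * Mp (2 * q)) := by
    have h2q := hMpos (2 * q)
    positivity
  have hmain := hdual _ (hvs.wderiv l.reverse) ((tsupport_wderiv_subset _).trans hvsupp) _ hA hκ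
  rw [← norm_integral_wderiv_mul l hu hvs huc] at hmain
  have hsq : ∫ x, wderiv l u x * v x = ((∫ x, ‖wderiv l u x‖ ^ 2 : ℝ) : ℂ) := by
    rw [← integral_complex_ofReal]
    congr 1 with x
    simp [hv, Complex.mul_conj']
  have hnn : 0 ≤ ∫ x, ‖wderiv l u x‖ ^ 2 :=
    MeasureTheory.integral_nonneg fun x => by positivity
  rw [hsq, Complex.norm_real, Real.norm_of_nonneg hnn] at hmain
  refine hmain.trans (mul_le_mul_of_nonneg_right ?_ hD)
  calc G * L ^ (2 * q) * (c * H ^ (2 * q) * Mp (2 * q))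
      ≤ G * L ^ (2 * q) * (c * H ^ (2 * q) * (c * H ^ (q + q) * Mp q * Mp q)) := by
        rw [two_mul q]
        gcongr
        exact hM2 q q
    _ = _ := by ring

theorem exists_norm_wderiv_pow_le {c H : ℝ} (hc : 1 ≤ c) (hH : 1 ≤ H) (hM2 : CondM2 Mp c H)
    (hMpos : ∀ p, 0 < Mp p) (hK : IsCompact K) {L : ℝ} (hL : 0 < L) :
    ∃ C : ℝ, 0 < C ∧ ∀ (u : EuclideanSpace ℝ (Fin d) → ℂ) (G D : ℝ),
      ContDiff ℝ (⊤ : ℕ∞) u → tsupport u ⊆ K → 0 < G → 0 ≤ D →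
      (∀ k x, ‖iteratedFDeriv ℝ k u x‖ ≤ G * L ^ k * Mp k) →
      (∀ κ : EuclideanSpace ℝ (Fin d) → ℂ, ContDiff ℝ (⊤ : ℕ∞) κ → tsupport κ ⊆ K →
        ∀ A, 0 < A → (∀ k x, ‖iteratedFDeriv ℝ k κ x‖ ≤ A * ((L * H) ^ k * Mp k)) →
          ‖∫ x, u x * κ x‖ ≤ A * D) →
      ∀ (l : List (Fin d)) x,
        (‖wderiv l u x‖ / ((L * H ^ 2) ^ l.length * Mp l.length)) ^ (d + 2) ≤
          C * G ^ (d + 1) * D := by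
  obtain ⟨C, hC, hsup⟩ := exists_norm_pow_le_of_lipschitz d
  have hH0 : 0 < H := by linarith
  have hM1 := hMpos 1
  refine ⟨C * (L * c * H * Mp 1) ^ d * c ^ 2, by positivity,
    fun u G D hu hsupp hG hD hbd hdual l x => ?_⟩
  set q := l.length with hq
  have hMq := hMpos q
  set w := (L * H ^ 2) ^ q * Mp q with hw
  have hwpos : 0 < w := by positivity
  have hB : 0 < G * (L * c * H * Mp 1) * w := by positivity
  have hcont : Continuous fun x => ‖wderiv l u x‖ ^ 2 :=
    (hu.wderiv l).continuous.norm.pow 2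
  have huc : HasCompactSupport (wderiv l u) :=
    hK.of_isClosed_subset (isClosed_tsupport _) ((tsupport_wderiv_subset l).trans hsupp)
  have hint : MeasureTheory.Integrable fun x => ‖wderiv l u x‖ ^ 2 :=
    hcont.integrable_of_hasCompactSupport
      (huc.comp_left (g := fun z : ℂ => ‖z‖ ^ 2) (by simp))
  have hder : ∀ y, ‖fderiv ℝ (wderiv l u) y‖ ≤ G * (L * c * H * Mp 1) * w := by
    intro y
    calc _ = ‖iteratedFDeriv ℝ 1 (wderiv l u) y‖ := by rw [norm_iteratedFDeriv_one]
      _ ≤ ‖iteratedFDeriv ℝ (1 + q) u y‖ := norm_iteratedFDeriv_wderiv_le l hu 1 y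
      _ ≤ G * L ^ (1 + q) * Mp (1 + q) := hbd _ y
      _ ≤ G * L ^ (1 + q) * (c * H ^ (1 + q) * Mp 1 * Mp q) := by
          gcongr
          exact hM2 1 q
      _ = G * (L * c * H * Mp 1) * ((L * H) ^ q * Mp q) := by ring
      _ ≤ _ := by
          rw [hw]
          gcongr
          exact le_self_pow₀ hH two_ne_zero
  have h := hsup _ _ _ hB ((hu.wderiv l).differentiable (by simp)) hder hint
    (integral_norm_sq_wderiv_le hc hH hM2 hMpos hK hu hsupp hG hL hD hbd hdual l) x
  rw [div_pow, div_le_iff₀ (by positivity)]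
  refine h.trans_eq ?_
  rw [← hq, ← hw]
  ring

/-- For compactly supported regular nets, rapid decay of the action on test functions upgrades to
rapid decay of all derivatives. -/
theorem exists_rapidBound_wderiv {c H : ℝ} (hc : 1 ≤ c) (hH : 1 ≤ H) (hM2 : CondM2 Mp c H)
    (hMpos : ∀ p, 0 < Mp p) (hM0 : Mp 0 = 1) (hK : IsCompact K) {s : ℕ → ℝ} (hs : InRcal s)
    {C₁ L₁ C₂ L₂ : ℝ} (hC₁ : 0 < C₁) (hL₁ : 0 < L₁) (hC₂ : 0 < C₂) (hL₂ : 0 < L₂) :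
    ∃ C L b : ℝ, 0 < C ∧ 0 < L ∧ 0 < b ∧
      ∀ (ε : ℝ) (u : EuclideanSpace ℝ (Fin d) → ℂ), 0 < ε →
      ContDiff ℝ (⊤ : ℕ∞) u → tsupport u ⊆ K →
      (∀ k x, ‖iteratedFDeriv ℝ k u x‖ ≤
        C₁ * Real.exp (assocN Mp s (1 / ε)) * L₁ ^ k * Mp k) →
      (∀ κ : EuclideanSpace ℝ (Fin d) → ℂ, ContDiff ℝ (⊤ : ℕ∞) κ → tsupport κ ⊆ K →
        ∀ A, 0 < A → (∀ k x, ‖iteratedFDeriv ℝ k κ x‖ ≤ A * ((L₁ * H) ^ k * Mp k)) →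
          ∀ p, ‖∫ x, u x * κ x‖ ≤ A * (C₂ * L₂ ^ p * Mp p * ε ^ p)) →
      ∀ (l : List (Fin d)) x,
        RapidBound Mp C L ε (‖wderiv l u x‖ / (b ^ l.length * Mp l.length)) := by
  have hH0 : 0 < H := by linarith
  obtain ⟨C₃, hC₃, h₃⟩ := exists_norm_wderiv_pow_le (d := d) hc hH hM2 hMpos hK hL₁
  obtain ⟨C₄, L₄, hC₄, hL₄, h₄⟩ := exists_rapidBound_exp_assocN_pow_mul hc hH hM2 hMpos hs (d + 1)
    (show 0 < C₃ * C₁ ^ (d + 1) * C₂ by positivity) hL₂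
  obtain ⟨C₅, L₅, hC₅, hL₅, h₅⟩ := exists_rapidBound_of_pow hc hH hM2 hMpos hM0
    (n := d + 2) (by omega) hC₄ hL₄
  refine ⟨C₅, L₅, L₁ * H ^ 2, hC₅, hL₅, by positivity,
    fun ε u hε hu hsupp hbd hdual l x => ?_⟩
  have hMl := hMpos l.length
  have hE := Real.exp_pos (assocN Mp s (1 / ε))
  set E := Real.exp (assocN Mp s (1 / ε)) with hEdef
  set Q := ‖wderiv l u x‖ / ((L₁ * H ^ 2) ^ l.length * Mp l.length) with hQ
  have hQ0 : 0 ≤ Q := by positivity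
  refine h₅ ε Q hε hQ0 ?_
  have h := h₄ ε (Q ^ (d + 2) / E ^ (d + 1)) hε (by positivity) fun p => by
    have hMp := hMpos p
    have := h₃ u (C₁ * E) (C₂ * L₂ ^ p * Mp p * ε ^ p) hu hsupp (by positivity)
      (by positivity) hbd (fun κ h1 h2 A hA h3 => hdual κ h1 h2 A hA h3 p) l x
    rw [div_le_iff₀ (by positivity)]
    refine this.trans_eq ?_
    ring
  rwa [← hEdef, mul_div_cancel₀ _ (by positivity)] at h

end Regularity

section Nets

variable {d : ℕ} {Mp : ℕ → ℝ} {K : Set (EuclideanSpace ℝ (Fin d))}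
  {f : ℝ → EuclideanSpace ℝ (Fin d) → ℂ}

theorem exists_iteratedFDeriv_bound (hMpos : ∀ p, 0 < Mp p)
    (hsmooth : ∀ ε ∈ Set.Ioo (0 : ℝ) 1, ContDiff ℝ (⊤ : ℕ∞) (f ε))
    (hsupp : ∀ ε ∈ Set.Ioo (0 : ℝ) 1, tsupport (f ε) ⊆ K) {s : ℕ → ℝ}
    (hreg : ∀ h : ℕ → ℝ, InRcal h →
      ∃ C : ℝ, 0 < C ∧ ∃ ε₁ ∈ Set.Ioo (0 : ℝ) 1,
        ∀ ε : ℝ, 0 < ε → ε < ε₁ → ∀ x ∈ K, ∀ α : Fin d → ℕ,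
          ‖mderiv α (f ε) x‖ / (Mp (∑ j, α j) * ∏ i ∈ Finset.range (∑ j, α j), h i) ≤
            C * Real.exp (assocN Mp s (1 / ε))) :
    ∃ C L : ℝ, 0 < C ∧ 0 < L ∧ ∃ ε₁ ∈ Set.Ioo (0 : ℝ) 1, ∀ ε : ℝ, 0 < ε → ε < ε₁ →
      ∀ k x, ‖iteratedFDeriv ℝ k (f ε) x‖ ≤
        C * Real.exp (assocN Mp s (1 / ε)) * L ^ k * Mp k := by
  obtain ⟨L, hL, ε₁, hε₁, hb⟩ := exists_geometric_bound (ι := K × (Fin d → ℕ))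
    (fun ε i => ‖mderiv i.2 (f ε) i.1‖ / (Mp (∑ j, i.2 j) * Real.exp (assocN Mp s (1 / ε))))
    (fun i => ∑ j, i.2 j) (by
      intro h hh
      obtain ⟨C, hC, ε₁, hε₁, hb⟩ := hreg h hh
      refine ⟨C, hC, ε₁, hε₁, fun ε h0 h1 i => ?_⟩
      have hM := hMpos (∑ j, i.2 j)
      have := hb ε h0 h1 i.1 i.1.2 i.2
      rw [div_le_iff₀ (mul_pos hM (hh.prod_pos _))] at this
      rw [div_le_iff₀ (by positivity)]
      refine this.trans_eq (by ring))
  refine ⟨L, (d + 1) * L, hL, by positivity, ε₁, hε₁, fun ε h0 h1 k x => ?_⟩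
  have hε : ε ∈ Set.Ioo (0 : ℝ) 1 := ⟨h0, h1.trans hε₁.2⟩
  have hM := hMpos k
  calc ‖iteratedFDeriv ℝ k (f ε) x‖
      ≤ (d : ℝ) ^ k * (L * L ^ k * (Mp k * Real.exp (assocN Mp s (1 / ε)))) := by
        refine norm_iteratedFDeriv_le_of_wderiv k (hsmooth ε hε) x _ fun l hl => ?_
        by_cases hx : x ∈ K
        · rw [wderiv_eq_mderiv l (hsmooth ε hε)]
          have := hb ε h0 h1 (⟨x, hx⟩, fun j => l.count j)
          simp only [sum_count_eq_length, hl] at this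
          rwa [div_le_iff₀ (by positivity)] at this
        · rw [image_eq_zero_of_notMem_tsupport
            fun h => hx (hsupp ε hε (tsupport_wderiv_subset l h)), norm_zero]
          positivity
    _ ≤ ((d : ℝ) + 1) ^ k * (L * L ^ k * (Mp k * Real.exp (assocN Mp s (1 / ε)))) := by
        gcongr
        linarith
    _ = _ := by
        rw [mul_pow]
        ring

theorem exists_dual_bound (hMpos : ∀ p, 0 < Mp p) (hM0 : Mp 0 = 1) (hM1 : CondM1 Mp)
    (hK : IsCompact K) (hsmooth : ∀ ε ∈ Set.Ioo (0 : ℝ) 1, ContDiff ℝ (⊤ : ℕ∞) (f ε))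
    (hsupp : ∀ ε ∈ Set.Ioo (0 : ℝ) 1, tsupport (f ε) ⊆ K) {ε₀ : ℝ} (hε₀ : ε₀ ∈ Set.Ioo (0 : ℝ) 1)
    (hweak : ∀ h : ℕ → ℝ, InRcal h →
        ∀ κ : EuclideanSpace ℝ (Fin d) → ℂ, ContDiff ℝ (⊤ : ℕ∞) κ → HasCompactSupport κ →
          (∀ r : ℕ → ℝ, InRcal r → ∃ B : ℝ, ∀ (x : EuclideanSpace ℝ (Fin d)) (α : Fin d → ℕ),
            ‖mderiv α κ x‖ ≤ B * (Mp (∑ j, α j) * ∏ i ∈ Finset.range (∑ j, α j), r i)) →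
          ∃ C : ℝ, 0 < C ∧ ∀ ε : ℝ, 0 < ε → ε < ε₀ →
            ‖∫ x : EuclideanSpace ℝ (Fin d), f ε x * κ x‖ *
              Real.exp (assocN Mp h (1 / ε)) ≤ C) {L : ℝ} (hL : 0 < L) :
    ∃ C₂ L₂ : ℝ, 0 < C₂ ∧ 0 < L₂ ∧ ∃ ε₁ ∈ Set.Ioo (0 : ℝ) 1, ∀ ε : ℝ, 0 < ε → ε < ε₁ →
      ∀ κ : EuclideanSpace ℝ (Fin d) → ℂ, ContDiff ℝ (⊤ : ℕ∞) κ → tsupport κ ⊆ K →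
        ∀ A, 0 < A → (∀ k x, ‖iteratedFDeriv ℝ k κ x‖ ≤ A * (L ^ k * Mp k)) →
          ∀ p, ‖∫ x, f ε x * κ x‖ ≤ A * (C₂ * L₂ ^ p * Mp p * ε ^ p) := by
  obtain ⟨L₂, hL₂, ε₁, hε₁, hb⟩ := exists_geometric_bound
    (ι := {q : (EuclideanSpace ℝ (Fin d) → ℂ) × ℝ // ContDiff ℝ (⊤ : ℕ∞) q.1 ∧ tsupport q.1 ⊆ K ∧
      0 < q.2 ∧ ∀ k x, ‖iteratedFDeriv ℝ k q.1 x‖ ≤ q.2 * (L ^ k * Mp k)} × ℕ)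
    (fun ε i => ‖∫ x, f ε x * i.1.1.1 x‖ / (i.1.1.2 * Mp i.2 * ε ^ i.2))
    (fun i => i.2) (by
      intro h hh
      obtain ⟨C, hC, hb⟩ := exists_uniform_bound_of_pointwise (J := Set.Ioo 0 ε₀)
        (W := fun k => L ^ k * Mp k) hK.isClosed
        (fun ε x => ((Real.exp (assocN Mp h (1 / ε)) : ℝ) : ℂ) * f ε x)
        (fun ε => by
          have hε : (ε : ℝ) ∈ Set.Ioo (0 : ℝ) 1 := ⟨ε.2.1, ε.2.2.trans hε₀.2⟩
          exact ((hsmooth ε hε).continuous.integrable_of_hasCompactSupport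
            (hK.of_isClosed_subset (isClosed_tsupport _) (hsupp ε hε))).const_mul _)
        (fun κ hκ hκK ⟨B, hB⟩ => by
          obtain ⟨C, -, hC⟩ := hweak h hh κ hκ
            (hK.of_isClosed_subset (isClosed_tsupport _) hκK) (fun r hr => by
              obtain ⟨C, hC, hr'⟩ := hr.exists_pow_le hL
              refine ⟨|B| * C, fun x α => ?_⟩
              have hM := hMpos (∑ j, α j)
              calc ‖mderiv α κ x‖ ≤ B * (L ^ (∑ j, α j) * Mp (∑ j, α j)) :=
                    (norm_mderiv_le α hκ x).trans (hB _ x)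
                _ ≤ |B| * ((C * ∏ i ∈ Finset.range (∑ j, α j), r i) * Mp (∑ j, α j)) := by
                    have := hr' (∑ j, α j)
                    gcongr
                    exact le_abs_self B
                _ = _ := by ring)
          refine ⟨C, fun ε => ?_⟩
          simp only [mul_assoc]
          rw [MeasureTheory.integral_const_mul, norm_mul, Complex.norm_real,
            Real.norm_of_nonneg (Real.exp_pos _).le, mul_comm]
          exact hC ε ε.2.1 ε.2.2)
      refine ⟨C, hC, ε₀, hε₀, fun ε h0 h1 => ?_⟩
      rintro ⟨⟨⟨κ, A⟩, hκ, hκK, hA, hbd⟩, p⟩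
      have h2 := hb κ hκ hκK A hA hbd ⟨ε, h0, h1⟩
      simp only [mul_assoc] at h2
      rw [MeasureTheory.integral_const_mul, norm_mul, Complex.norm_real,
        Real.norm_of_nonneg (Real.exp_pos _).le] at h2
      have hM := hMpos p
      have hP := hh.prod_pos p
      have h3 := pow_div_le_exp_assocN hM1 hMpos hM0 hh (one_div_pos.2 h0) p
      have h4 := (mul_le_mul_of_nonneg_right h3
        (norm_nonneg (∫ x, f ε x * κ x))).trans h2
      change ‖∫ x, f ε x * κ x‖ / (A * Mp p * ε ^ p) ≤ _
      rw [div_le_iff₀ (by positivity)]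
      rw [div_mul_eq_mul_div, div_le_iff₀ (by positivity), one_div, inv_pow,
        inv_mul_le_iff₀ (by positivity)] at h4
      refine h4.trans_eq (by ring))
  refine ⟨L₂, L₂, hL₂, hL₂, ε₁, hε₁, fun ε h0 h1 κ hκ hκK A hA hbd p => ?_⟩
  have hM := hMpos p
  have h2 := hb ε h0 h1 (⟨(κ, A), hκ, hκK, hA, hbd⟩, p)
  rw [div_le_iff₀ (by positivity)] at h2
  refine h2.trans_eq ?_
  simp only
  ring

theorem NegligibleR.exists_integral_bound (hMpos : ∀ p, 0 < Mp p) (hM0 : Mp 0 = 1)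
    (hM1 : CondM1 Mp) (hK : IsCompact K)
    (hsupp : ∀ ε ∈ Set.Ioo (0 : ℝ) 1, tsupport (f ε) ⊆ K) {s : ℕ → ℝ} (hs : InRcal s)
    {C₁ ε₁ : ℝ} (hε₁ : ε₁ ∈ Set.Ioo (0 : ℝ) 1)
    (hreg : ∀ ε : ℝ, 0 < ε → ε < ε₁ → ∀ x ∈ K, ‖f ε x‖ ≤ C₁ * Real.exp (assocN Mp s (1 / ε)))
    (hneg : NegligibleR Mp f) {h : ℕ → ℝ} (hh : InRcal h)
    {κ : EuclideanSpace ℝ (Fin d) → ℂ} (hκ : Continuous κ) (hκc : HasCompactSupport κ) :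
    ∃ C : ℝ, 0 < C ∧ ∀ ε : ℝ, 0 < ε → ε < ε₁ →
      ‖∫ x : EuclideanSpace ℝ (Fin d), f ε x * κ x‖ * Real.exp (assocN Mp h (1 / ε)) ≤ C := by
  obtain ⟨C₂, hC₂, ε₂, hε₂, hb⟩ := hneg K hK _ inRcal_natCast_add_one h hh
  have hsmall : ∀ ε, 0 < ε → ε < ε₂ → ∀ x ∈ K,
      ‖f ε x‖ * Real.exp (assocN Mp h (1 / ε)) ≤ C₂ := by
    intro ε h0 h1 x hx
    have := hb ε h0 h1 x hx 0
    simp only [mderiv_zero, Pi.zero_apply, Finset.sum_const_zero, hM0, Finset.range_zero,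
      Finset.prod_empty, mul_one, div_one] at this
    rw [Real.exp_neg, ← div_eq_mul_inv, le_div_iff₀ (Real.exp_pos _)] at this
    exact this
  obtain ⟨B, hB⟩ := hκc.exists_bound_of_continuous hκ
  have hB0 : 0 ≤ B := (norm_nonneg _).trans (hB 0)
  set C₃ := max C₂ (|C₁| * Real.exp (assocN Mp s (1 / ε₂)) * Real.exp (assocN Mp h (1 / ε₂)))
    with hC₃
  have hC₃pos : 0 < C₃ := hC₂.trans_le (le_max_left _ _)
  have hall : ∀ ε, 0 < ε → ε < ε₁ → ∀ x ∈ K,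
      ‖f ε x‖ * Real.exp (assocN Mp h (1 / ε)) ≤ C₃ := by
    intro ε h0 h1 x hx
    rcases lt_or_ge ε ε₂ with h2 | h2
    · exact (hsmall ε h0 h2 x hx).trans (le_max_left _ _)
    · refine le_trans ?_ (le_max_right _ _)
      have hinv : 1 / ε ≤ 1 / ε₂ := one_div_le_one_div_of_le hε₂.1 h2
      have hinv0 : 0 < 1 / ε := one_div_pos.2 h0
      have := hreg ε h0 h1 x hx
      have h3 := assocN_mono hM1 hMpos hM0 hs hinv0 hinv
      have h4 := assocN_mono hM1 hMpos hM0 hh hinv0 hinv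
      calc _ ≤ |C₁| * Real.exp (assocN Mp s (1 / ε)) * Real.exp (assocN Mp h (1 / ε)) := by
            gcongr
            refine this.trans ?_
            gcongr
            exact le_abs_self _
        _ ≤ _ := by gcongr
  refine ⟨C₃ * B * MeasureTheory.volume.real K + 1, by positivity, fun ε h0 h1 => ?_⟩
  have hε : ε ∈ Set.Ioo (0 : ℝ) 1 := ⟨h0, h1.trans hε₁.2⟩
  set E := Real.exp (assocN Mp h (1 / ε)) with hE
  have hEpos : 0 < E := Real.exp_pos _
  have hset : ∫ x, f ε x * κ x = ∫ x in K, f ε x * κ x := by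
    symm
    refine MeasureTheory.setIntegral_eq_integral_of_forall_compl_eq_zero fun x hx => ?_
    rw [image_eq_zero_of_notMem_tsupport fun h => hx (hsupp ε hε h), zero_mul]
  have hnorm : ‖∫ x in K, f ε x * κ x‖ ≤ C₃ / E * B * MeasureTheory.volume.real K := by
    refine MeasureTheory.norm_setIntegral_le_of_norm_le_const hK.measure_lt_top fun x hx => ?_
    rw [norm_mul]
    exact mul_le_mul ((le_div_iff₀ hEpos).2 (hall ε h0 h1 x hx)) (hB x) (norm_nonneg _)
      (by positivity)
  rw [hset]
  calc _ ≤ C₃ / E * B * MeasureTheory.volume.real K * E := by gcongr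
    _ = C₃ * B * MeasureTheory.volume.real K := by field_simp
    _ ≤ _ := by linarith

end Nets

theorem stmt16 {d : ℕ} (Mp : ℕ → ℝ) (hMpos : ∀ p, 0 < Mp p) (hM0 : Mp 0 = 1)
    (hM1 : CondM1 Mp) (hM2 : CondM2' Mp) (hM3 : CondM3 Mp)
    (K : Set (EuclideanSpace ℝ (Fin d))) (hK : IsCompact K)
    (f : ℝ → EuclideanSpace ℝ (Fin d) → ℂ)
    (hsmooth : ∀ ε ∈ Set.Ioo (0 : ℝ) 1, ContDiff ℝ (⊤ : ℕ∞) (f ε))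
    (hsupp : ∀ ε ∈ Set.Ioo (0 : ℝ) 1, tsupport (f ε) ⊆ K)
    (hreg : ∃ s : ℕ → ℝ, InRcal s ∧ ∀ h : ℕ → ℝ, InRcal h →
      ∃ C : ℝ, 0 < C ∧ ∃ ε₁ ∈ Set.Ioo (0 : ℝ) 1,
        ∀ ε : ℝ, 0 < ε → ε < ε₁ → ∀ x ∈ K, ∀ α : Fin d → ℕ,
          ‖mderiv α (f ε) x‖ / (Mp (∑ j, α j) * ∏ i ∈ Finset.range (∑ j, α j), h i) ≤
            C * Real.exp (assocN Mp s (1 / ε))) :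
    NegligibleR Mp f ↔
      ∃ ε₀ ∈ Set.Ioo (0 : ℝ) 1, ∀ h : ℕ → ℝ, InRcal h →
        ∀ κ : EuclideanSpace ℝ (Fin d) → ℂ, ContDiff ℝ (⊤ : ℕ∞) κ → HasCompactSupport κ →
          (∀ r : ℕ → ℝ, InRcal r → ∃ B : ℝ, ∀ (x : EuclideanSpace ℝ (Fin d)) (α : Fin d → ℕ),
            ‖mderiv α κ x‖ ≤ B * (Mp (∑ j, α j) * ∏ i ∈ Finset.range (∑ j, α j), r i)) →
          ∃ C : ℝ, 0 < C ∧ ∀ ε : ℝ, 0 < ε → ε < ε₀ →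
            ‖∫ x : EuclideanSpace ℝ (Fin d), f ε x * κ x‖ *
              Real.exp (assocN Mp h (1 / ε)) ≤ C := by
  obtain ⟨c, H, hc, hH, hM2⟩ := hM2
  obtain ⟨s, hs, hreg⟩ := hreg
  constructor
  · intro hneg
    obtain ⟨C₁, -, ε₁, hε₁, hb⟩ := hreg _ inRcal_natCast_add_one
    refine ⟨ε₁, hε₁, fun h hh κ hκ hκc _ =>
      hneg.exists_integral_bound hMpos hM0 hM1 hK hsupp hs (C₁ := C₁) hε₁ ?_ hh hκ.continuous hκc⟩
    intro ε h0 h1 x hx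
    have := hb ε h0 h1 x hx 0
    rw [mderiv_zero] at this
    simpa [hM0] using this
  · rintro ⟨ε₀, hε₀, hweak⟩
    obtain ⟨C₁, L₁, hC₁, hL₁, ε₁, hε₁, h₁⟩ :=
      exists_iteratedFDeriv_bound hMpos hsmooth hsupp hreg
    obtain ⟨C₂, L₂, hC₂, hL₂, ε₂, hε₂, h₂⟩ := exists_dual_bound hMpos hM0 hM1 hK hsmooth hsupp
      hε₀ hweak (L := L₁ * H) (by positivity)
    obtain ⟨C₃, L₃, b, hC₃, hL₃, hb, h₃⟩ := exists_rapidBound_wderiv (d := d) hc hH hM2 hMpos hM0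
      hK hs hC₁ hL₁ hC₂ hL₂
    intro K' _ h hh k hk
    obtain ⟨C₄, L₄, hC₄, -, h₄⟩ :=
      exists_rapidBound_exp_assocN_mul hc hH hM2 hMpos hk hC₃ hL₃
    obtain ⟨C₅, hC₅, h₅⟩ := hh.exists_pow_le hb
    refine ⟨C₄ * C₅, by positivity, min ε₁ ε₂,
      ⟨lt_min hε₁.1 hε₂.1, (min_le_left _ _).trans_lt hε₁.2⟩, fun ε h0 hlt x _ α => ?_⟩
    have hlt₁ := hlt.trans_le (min_le_left _ _)
    have hε : ε ∈ Set.Ioo (0 : ℝ) 1 := ⟨h0, hlt₁.trans hε₁.2⟩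
    have hrapid := h₃ ε (f ε) h0 (hsmooth ε hε) (hsupp ε hε) (h₁ ε h0 hlt₁)
      (h₂ ε h0 (hlt.trans_le (min_le_right _ _)))
      ((List.finRange d).flatMap fun j => List.replicate (α j) j) x
    rw [← mderiv_eq_wderiv, length_flatMap_replicate] at hrapid
    set q := ∑ j, α j with hq
    have hMq := hMpos q
    have hP := hh.prod_pos q
    have hfin := h₄ ε _ h0 (by positivity) hrapid 0
    rw [pow_zero, pow_zero, hM0, mul_one, mul_one, mul_one, mul_comm,
      ← le_div_iff₀ (Real.exp_pos _), div_le_iff₀ (by positivity)] at hfin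
    rw [div_le_iff₀ (by positivity), Real.exp_neg]
    calc _ ≤ C₄ / Real.exp (assocN Mp k (1 / ε)) * (b ^ q * Mp q) := hfin
      _ ≤ C₄ / Real.exp (assocN Mp k (1 / ε)) *
          ((C₅ * ∏ i ∈ Finset.range q, h i) * Mp q) := by
          have := h₅ q
          gcongr
      _ = _ := by ring
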